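/- Let H be a countable group and K a sofic group. If the pair {e} < H (the trivial subgroup of H) is relatively sofic over K, then H is sofic. -/

import Mathlib

universe u v

/-- Normalized Hamming distance between two permutations of a (finite) type. -/
noncomputable def permDist {A : Type*} (σ τ : Equiv.Perm A) : ℝ :=
  (Set.ncard {a | σ a ≠ τ a} : ℝ) / (Nat.card A : ℝ)

/-- A group is sofic if every finite subset admits `(F, ε)`-approximations by permutations. -/
def IsSofic (G : Type*) [Group G] : Prop :=
  ∀ (F : Finset G) (ε : ℝ), 0 < ε →
    ∃ A : Type, Finite A ∧ Nonempty A ∧ ∃ φ : G → Equiv.Perm A,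
      φ 1 = 1 ∧
      (∀ g ∈ F, ∀ h ∈ F, permDist (φ (g * h)) (φ g * φ h) < ε) ∧
      (∀ g ∈ F, g ≠ 1 → 1 - ε < permDist (φ g) 1)


/-- A group is amenable if it carries a left-invariant finitely additive
probability measure defined on all subsets. -/
def IsAmenable (G : Type*) [Group G] : Prop :=
  ∃ m : Set G → ℝ,
    (∀ A : Set G, 0 ≤ m A) ∧
    m Set.univ = 1 ∧
    (∀ A B : Set G, Disjoint A B → m (A ∪ B) = m A + m B) ∧
    (∀ (g : G) (A : Set G), m ((g * ·) '' A) = m A)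


/-- The subgroup of sequences equal to the identity ω-almost everywhere. -/
def upKer {ι : Type*} (ω : Ultrafilter ι) (G : ι → Type*) [∀ i, Group (G i)] :
    Subgroup (∀ i, G i) where
  carrier := {f | ∀ᶠ i in (ω : Filter ι), f i = 1}
  one_mem' := Filter.Eventually.of_forall fun _ => rfl
  mul_mem' := by
    intro a b ha hb
    filter_upwards [ha, hb] with i h1 h2
    simp [h1, h2]
  inv_mem' := by
    intro a ha
    filter_upwards [ha] with i h1
    simp [h1]

instance upKer_normal {ι : Type*} (ω : Ultrafilter ι) (G : ι → Type*) [∀ i, Group (G i)] :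
    (upKer ω G).Normal := by
  constructor
  intro a ha g
  filter_upwards [ha] with i h1
  simp [h1]

/-- The algebraic ultraproduct of a family of groups along an ultrafilter. -/
def Ultraproduct {ι : Type*} (ω : Ultrafilter ι) (G : ι → Type*) [∀ i, Group (G i)] :=
  (∀ i, G i) ⧸ upKer ω G

instance {ι : Type*} (ω : Ultrafilter ι) (G : ι → Type*) [∀ i, Group (G i)] :
    Group (Ultraproduct ω G) :=
  QuotientGroup.Quotient.group _

/-- The subgroup `∏_ω H_i` of the algebraic ultraproduct `∏_ω G_i`. -/
def upSubgroup {ι : Type*} (ω : Ultrafilter ι) {G : ι → Type*} [∀ i, Group (G i)]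
    (H : ∀ i, Subgroup (G i)) : Subgroup (Ultraproduct ω G) :=
  Subgroup.map (QuotientGroup.mk' (upKer ω G)) (Subgroup.pi Set.univ H)


/-- A witness to relative soficity of `H < G` over `K`. -/
structure RelSoficWitness {G : Type*} [Group G] (H : Subgroup G) (K : Type*) [Group K] where
  Gi : ℕ → Type u
  [instGi : ∀ i, Group (Gi i)]
  Hi : ∀ i, Subgroup (Gi i)
  ω : Ultrafilter ℕ
  free : ∀ s : Set ℕ, s.Finite → s ∉ ω
  sofic : ∀ i, IsSofic (Gi i)
  amenable : ∀ i, IsAmenable (Hi i)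
  π : G →* Ultraproduct ω (fun i => Gi i × K)
  inj : Function.Injective π
  inter : Subgroup.map π ⊤ ⊓ upSubgroup ω (fun i => (Hi i).prod ⊤) = Subgroup.map π H

/-- `H < G` is relatively sofic over `K`. -/
def RelativelySofic {G : Type*} [Group G] (H : Subgroup G) (K : Type*) [Group K] : Prop :=
  Nonempty (RelSoficWitness.{u} H K)


theorem permDist_prod {A B : Type*} [Finite A] [Finite B] [Nonempty A] [Nonempty B]
    (s s' : Equiv.Perm A) (t t' : Equiv.Perm B) :
    permDist (Equiv.prodCongr s t) (Equiv.prodCongr s' t') ≤ permDist s s' + permDist t t' ∧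
    permDist s s' ≤ permDist (Equiv.prodCongr s t) (Equiv.prodCongr s' t') ∧
    permDist t t' ≤ permDist (Equiv.prodCongr s t) (Equiv.prodCongr s' t') := by
  have hA : (0 : ℝ) < Nat.card A := by exact_mod_cast Nat.card_pos
  have hB : (0 : ℝ) < Nat.card B := by exact_mod_cast Nat.card_pos
  have hset : {a : A × B | (Equiv.prodCongr s t) a ≠ (Equiv.prodCongr s' t') a} =
      ({a | s a ≠ s' a} ×ˢ Set.univ) ∪ (Set.univ ×ˢ {b | t b ≠ t' b}) := by
    ext ⟨a, b⟩
    simp [Prod.ext_iff]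
    tauto
  have e1 : permDist s s' =
      (Set.ncard ({a | s a ≠ s' a} ×ˢ (Set.univ : Set B)) : ℝ) / (Nat.card (A × B) : ℝ) := by
    rw [Set.ncard_prod, Set.ncard_univ, Nat.card_prod, permDist]
    push_cast
    field_simp
  have e2 : permDist t t' =
      (Set.ncard ((Set.univ : Set A) ×ˢ {b | t b ≠ t' b}) : ℝ) / (Nat.card (A × B) : ℝ) := by
    rw [Set.ncard_prod, Set.ncard_univ, Nat.card_prod, permDist]
    push_cast
    field_simp
  rw [e1, e2]
  unfold permDist
  rw [hset, ← add_div]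
  refine ⟨?_, ?_, ?_⟩
  · gcongr
    exact_mod_cast Set.ncard_union_le _ _
  · gcongr
    · exact Set.toFinite _
    · exact Set.subset_union_left
  · gcongr
    · exact Set.toFinite _
    · exact Set.subset_union_right

theorem IsSofic.prod {G K : Type*} [Group G] [Group K] (hG : IsSofic G) (hK : IsSofic K) :
    IsSofic (G × K) := by
  classical
  intro F ε hε
  obtain ⟨A, hA, hA', φ, φ1, φm, φd⟩ := hG (F.image Prod.fst) (ε / 2) (half_pos hε)
  obtain ⟨B, hB, hB', ψ, ψ1, ψm, ψd⟩ := hK (F.image Prod.snd) (ε / 2) (half_pos hε)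
  refine ⟨A × B, inferInstance, inferInstance, fun g => Equiv.prodCongr (φ g.1) (ψ g.2), ?_, ?_, ?_⟩
  · ext x <;> simp [φ1, ψ1]
  · intro g hg h hh
    have h1 := φm _ (Finset.mem_image_of_mem _ hg) _ (Finset.mem_image_of_mem _ hh)
    have h2 := ψm _ (Finset.mem_image_of_mem _ hg) _ (Finset.mem_image_of_mem _ hh)
    have h3 := (permDist_prod (φ (g.1 * h.1)) (φ g.1 * φ h.1) (ψ (g.2 * h.2)) (ψ g.2 * ψ h.2)).1
    exact lt_of_le_of_lt h3 (by linarith)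
  · intro g hg hne
    have h3 := (permDist_prod (φ g.1) 1 (ψ g.2) 1).2
    change 1 - ε < permDist (Equiv.prodCongr (φ g.1) (ψ g.2)) (Equiv.prodCongr 1 1)
    by_cases h1 : g.1 = 1
    · have h2 : g.2 ≠ 1 := fun h2 => hne (Prod.ext h1 h2)
      have := ψd _ (Finset.mem_image_of_mem _ hg) h2
      linarith [h3.2]
    · have := φd _ (Finset.mem_image_of_mem _ hg) h1
      linarith [h3.1]

theorem isSofic_of_ultraproduct {H : Type*} [Group H] (ω : Ultrafilter ℕ) (G : ℕ → Type*)
    [∀ i, Group (G i)] (hG : ∀ i, IsSofic (G i)) (π : H →* Ultraproduct ω G)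
    (hπ : Function.Injective π) : IsSofic H := by
  classical
  have hs : ∀ g : H, ∃ f : ∀ i, G i, QuotientGroup.mk' (upKer ω G) f = π g :=
    fun g => QuotientGroup.mk'_surjective _ (π g)
  choose s hs using hs
  intro F ε hε
  have hone : ∀ᶠ i in (ω : Filter ℕ), s 1 i = 1 := by
    have : s 1 ∈ upKer ω G := by
      rw [← QuotientGroup.ker_mk' (upKer ω G), MonoidHom.mem_ker, hs, map_one]; rfl
    exact this
  have hmul : ∀ g h : H, ∀ᶠ i in (ω : Filter ℕ), s (g * h) i = s g i * s h i := by
    intro g h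
    have : (s (g * h))⁻¹ * (s g * s h) ∈ upKer ω G := by
      rw [← QuotientGroup.eq]
      have h1 := hs (g * h)
      rw [map_mul, ← hs, ← hs] at h1
      exact h1
    have this : ∀ᶠ i in (ω : Filter ℕ), ((s (g * h))⁻¹ * (s g * s h)) i = 1 := this
    filter_upwards [this] with i hi
    exact inv_mul_eq_one.mp hi
  have hne : ∀ g : H, g ≠ 1 → ∀ᶠ i in (ω : Filter ℕ), s g i ≠ 1 := by
    intro g hg
    rw [Ultrafilter.eventually_not]
    intro hc
    apply hg
    apply hπ
    have hc : s g ∈ upKer ω G := hc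
    rw [← QuotientGroup.ker_mk' (upKer ω G), MonoidHom.mem_ker, hs] at hc
    rw [map_one]
    exact hc
  have key : ∀ᶠ i in (ω : Filter ℕ), s 1 i = 1 ∧
      (∀ g ∈ F, ∀ h ∈ F, s (g * h) i = s g i * s h i) ∧ ∀ g ∈ F, g ≠ 1 → s g i ≠ 1 := by
    refine hone.and (Filter.Eventually.and ?_ ?_)
    · rw [Filter.eventually_all_finset]
      intro g _
      rw [Filter.eventually_all_finset]
      intro h _
      exact hmul g h
    · rw [Filter.eventually_all_finset]
      intro g _
      by_cases hg : g = 1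
      · simp [hg]
      · simpa [hg] using hne g hg
  obtain ⟨i, h1, hm, hn⟩ := key.exists
  obtain ⟨A, hA, hA', φ, φ1, φm, φd⟩ := hG i (F.image fun g => s g i) ε hε
  refine ⟨A, hA, hA', fun g => φ (s g i), by simp only [h1, φ1], ?_, ?_⟩
  · intro g hg h hh
    simp only [hm g hg h hh]
    exact φm _ (Finset.mem_image_of_mem _ hg) _ (Finset.mem_image_of_mem _ hh)
  · intro g hg hg1
    exact φd _ (Finset.mem_image_of_mem _ hg) (hn g hg hg1)

/-- If the trivial subgroup `{e} < H` is relatively sofic over a sofic group `K`, then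
`H` is sofic. -/
theorem isSofic_of_bot_relativelySofic {H : Type*} [Group H] [Countable H]
    (K : Type*) [Group K] (hK : IsSofic K)
    (h : RelativelySofic.{u} (⊥ : Subgroup H) K) :
    IsSofic H := by
  obtain ⟨w⟩ := h
  letI := w.instGi
  exact isSofic_of_ultraproduct w.ω (fun i => w.Gi i × K) (fun i => (w.sofic i).prod hK) w.π w.inj
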